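/- arXiv:2402.17839 — 10 statements merged into one kernel-verified Lean document; each statement's English description precedes it below -/
import Mathlib

section
/- Let F be a field of characteristic zero and let n ≥ 3. The ideal I_{2,n} generated by the permanents of all 2×2 submatrices of the generic 2×n matrix has height n; equivalently, the variety P_{2,n} = {prk(M) ≤ 1} has codimension n in F^{2×n}. -/
open MvPolynomial

noncomputable section

/-- The permanent of a square matrix. -/
def perm {R : Type*} [CommRing R] {m : ℕ} (A : Matrix (Fin m) (Fin m) R) : R :=
  ∑ σ : Equiv.Perm (Fin m), ∏ i, A i (σ i)

/-- The height of an ideal: the infimum of the heights (in the prime spectrum)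
of the primes containing it. -/
def idealHeight {R : Type*} [CommRing R] (I : Ideal R) : ℕ∞ :=
  ⨅ (p : PrimeSpectrum R) (_ : I ≤ p.asIdeal), Order.height p

/-- The ideal generated by the permanents of all `2 × 2` submatrices of the generic
`2 × n` matrix. -/
def permanentalIdeal (F : Type*) [Field F] (n : ℕ) : Ideal (MvPolynomial (Fin 2 × Fin n) F) :=
  Ideal.span { p | ∃ c : Fin 2 → Fin n, StrictMono c ∧
    p = perm (Matrix.of fun i j => X (i, c j)) }

namespace MvPolynomial

variable {σ F : Type*} [Field F]

theorem span_X_image_eq_ker_aeval (s : Set σ) [DecidablePred (· ∈ s)] :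
    Ideal.span (X '' s : Set (MvPolynomial σ F)) =
      RingHom.ker (aeval fun v => if v ∈ s then (0 : MvPolynomial σ F) else X v) := by
  apply le_antisymm
  · rw [Ideal.span_le]
    rintro _ ⟨v, hv, rfl⟩
    simp [RingHom.mem_ker, hv]
  · set φ : MvPolynomial σ F →ₐ[F] MvPolynomial σ F :=
      aeval fun v => if v ∈ s then (0 : MvPolynomial σ F) else X v with hφ
    have hmk : (Ideal.Quotient.mkₐ F (Ideal.span (X '' s))).comp φ =
        Ideal.Quotient.mkₐ F (Ideal.span (X '' s)) := by
      ext v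
      by_cases hv : v ∈ s
      · simpa [hφ, hv] using (Ideal.Quotient.eq_zero_iff_mem.mpr
          (Ideal.subset_span (Set.mem_image_of_mem X hv))).symm
      · simp [hφ, hv]
    intro f hf
    have hf0 : φ f = 0 := hf
    have h := DFunLike.congr_fun hmk f
    rw [AlgHom.comp_apply, hf0, map_zero] at h
    exact Ideal.Quotient.eq_zero_iff_mem.mp h.symm

instance isPrime_span_X_image (s : Set σ) :
    (Ideal.span (X '' s : Set (MvPolynomial σ F))).IsPrime := by
  classical
  rw [span_X_image_eq_ker_aeval]
  exact RingHom.ker_isPrime _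

theorem card_le_height_span_X_image (s : Finset σ) :
    (s.card : ℕ∞) ≤ (Ideal.span (X '' (s : Set σ) : Set (MvPolynomial σ F))).height := by
  classical
  induction s using Finset.induction_on with
  | empty => simp
  | insert v s hv ih =>
    have hlt : Ideal.span (X '' (s : Set σ) : Set (MvPolynomial σ F)) <
        Ideal.span (X '' ((insert v s : Finset σ) : Set σ)) := by
      refine lt_of_le_of_ne (Ideal.span_mono (Set.image_mono (by simp))) fun h => ?_
      have hmem : (X v : MvPolynomial σ F) ∈ Ideal.span (X '' (s : Set σ)) :=
        h ▸ Ideal.subset_span (Set.mem_image_of_mem X (by simp))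
      rw [span_X_image_eq_ker_aeval, RingHom.mem_ker] at hmem
      simp [hv] at hmem
    rw [Finset.card_insert_of_notMem hv, Nat.cast_add, Nat.cast_one]
    exact (add_le_add_left ih 1).trans (Ideal.height_add_one_le_of_lt_of_isPrime hlt)

theorem card_le_height_of_X_mem (s : Finset σ) (p : Ideal (MvPolynomial σ F))
    (h : ∀ v ∈ s, X v ∈ p) : (s.card : ℕ∞) ≤ p.height := by
  refine (card_le_height_span_X_image s).trans (Ideal.height_mono (Ideal.span_le.mpr ?_))
  rintro _ ⟨v, hv, rfl⟩
  exact h v hv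

theorem height_span_X_image_le_card [Finite σ] (s : Finset σ) :
    (Ideal.span (X '' (s : Set σ) : Set (MvPolynomial σ F))).height ≤ s.card := by
  classical
  have hmem : Ideal.span (X '' (s : Set σ) : Set (MvPolynomial σ F)) ∈
      (Ideal.span ((s.image X : Finset (MvPolynomial σ F)) : Set _)).minimalPrimes := by
    rw [Finset.coe_image, Ideal.minimalPrimes_eq_subsingleton_self]
    rfl
  exact (Ideal.height_le_card_of_mem_minimalPrimes_span_finset hmem).trans
    (by exact_mod_cast Finset.card_image_le)

end MvPolynomial

section PermanentalIdeal

variable {F : Type*} [Field F] {n : ℕ}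

theorem perm_fin_two {R : Type*} [CommRing R] (A : Matrix (Fin 2) (Fin 2) R) :
    perm A = A 0 0 * A 1 1 + A 0 1 * A 1 0 := by
  have huniv : (Finset.univ : Finset (Equiv.Perm (Fin 2))) = {1, Equiv.swap 0 1} := by decide
  rw [perm, huniv, Finset.sum_pair (by decide)]
  simp [Fin.prod_univ_two]

theorem permanent_mem_permanentalIdeal {i j : Fin n} (hij : i ≠ j) :
    (X (0, i) * X (1, j) + X (0, j) * X (1, i) : MvPolynomial (Fin 2 × Fin n) F) ∈
      permanentalIdeal F n := by
  have key : ∀ {i j : Fin n}, i < j →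
      (X (0, i) * X (1, j) + X (0, j) * X (1, i) : MvPolynomial (Fin 2 × Fin n) F) ∈
        permanentalIdeal F n := fun {i j} h => by
    refine Ideal.subset_span ⟨![i, j], ?_, ?_⟩
    · simpa [Fin.strictMono_iff_lt_succ] using h
    · simp [perm_fin_two]
  rcases lt_or_gt_of_ne hij with h | h
  · exact key h
  · rw [add_comm]
    exact key h

theorem permanentalIdeal_le_span_second_row :
    permanentalIdeal F n ≤
      Ideal.span (X '' ((Finset.univ.image fun j : Fin n => ((1 : Fin 2), j) : Finset _) :
        Set (Fin 2 × Fin n))) := by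
  refine Ideal.span_le.mpr ?_
  rintro _ ⟨c, -, rfl⟩
  have hX : ∀ j : Fin n, (X (1, j) : MvPolynomial (Fin 2 × Fin n) F) ∈
      Ideal.span (X '' ((Finset.univ.image fun j : Fin n => ((1 : Fin 2), j) : Finset _) :
        Set (Fin 2 × Fin n))) :=
    fun j => Ideal.subset_span (Set.mem_image_of_mem X (by simp))
  rw [perm_fin_two]
  exact add_mem (Ideal.mul_mem_left _ _ (hX _)) (Ideal.mul_mem_left _ _ (hX _))

theorem le_height_of_row_mem (p : Ideal (MvPolynomial (Fin 2 × Fin n) F)) (r : Fin 2)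
    (h : ∀ j, X (r, j) ∈ p) : (n : ℕ∞) ≤ p.height := by
  have := card_le_height_of_X_mem (Finset.univ.image fun j : Fin n => (r, j)) p (by simpa using h)
  rwa [Finset.card_image_of_injective _ (Prod.mk_right_injective r), Finset.card_univ,
    Fintype.card_fin] at this

/-- A prime containing the permanental ideal and all variables outside two columns also contains
the permanent of those two columns, which does not lie in the ideal of these variables. -/
theorem le_height_of_columns_mem {p : Ideal (MvPolynomial (Fin 2 × Fin n) F)} [p.IsPrime]
    (hp : permanentalIdeal F n ≤ p) {i j : Fin n} (hij : i ≠ j)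
    (h : ∀ r k, k ≠ i → k ≠ j → X (r, k) ∈ p) : ((2 * (n - 2) + 1 : ℕ) : ℕ∞) ≤ p.height := by
  classical
  set s : Finset (Fin 2 × Fin n) := Finset.univ ×ˢ {i, j}ᶜ with hs
  have hcard : s.card = 2 * (n - 2) := by
    rw [hs, Finset.card_product, Finset.card_compl, Finset.card_pair hij]
    simp
  have hle : Ideal.span (X '' (s : Set (Fin 2 × Fin n))) ≤ p := by
    refine Ideal.span_le.mpr ?_
    rintro _ ⟨⟨r, k⟩, hk, rfl⟩
    have hk' : k ≠ i ∧ k ≠ j := by simpa [hs, and_comm] using hk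
    exact h r k hk'.1 hk'.2
  have hnot : (X (0, i) * X (1, j) + X (0, j) * X (1, i) : MvPolynomial (Fin 2 × Fin n) F) ∉
      Ideal.span (X '' (s : Set (Fin 2 × Fin n))) := by
    rw [span_X_image_eq_ker_aeval, RingHom.mem_ker]
    intro h0
    have := congrArg (eval fun v => if v = (0, i) ∨ v = (1, j) then (1 : F) else 0) h0
    simp [hs, hij, hij.symm] at this
  have hlt : Ideal.span (X '' (s : Set (Fin 2 × Fin n))) < p :=
    lt_of_le_of_ne hle fun he => hnot (he ▸ hp (permanent_mem_permanentalIdeal hij))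
  have hs' := card_le_height_span_X_image (F := F) s
  rw [hcard] at hs'
  rw [Nat.cast_add, Nat.cast_one]
  exact (add_le_add_left hs' 1).trans (Ideal.height_add_one_le_of_lt_of_isPrime hlt)

theorem X_zero_mem_iff_X_one_mem {p : Ideal (MvPolynomial (Fin 2 × Fin n) F)} [hp : p.IsPrime]
    (hI : permanentalIdeal F n ≤ p) {i : Fin n} (h0 : X (0, i) ∉ p) (h1 : X (1, i) ∉ p)
    (k : Fin n) : X (0, k) ∈ p ↔ X (1, k) ∈ p := by
  rcases eq_or_ne i k with rfl | hik
  · exact iff_of_false h0 h1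
  have hf := hI (permanent_mem_permanentalIdeal hik)
  constructor <;> intro h
  · rw [p.add_mem_iff_left (p.mul_mem_right _ h)] at hf
    exact (hp.mem_or_mem hf).resolve_left h0
  · rw [p.add_mem_iff_right (p.mul_mem_left _ h)] at hf
    exact (hp.mem_or_mem hf).resolve_right h1

theorem X_mul_X_mul_X_mem_permanentalIdeal [CharZero F] {i j k : Fin n} (hij : i ≠ j) (hik : i ≠ k)
    (hjk : j ≠ k) :
    (X (0, i) * X (0, j) * X (1, k) : MvPolynomial (Fin 2 × Fin n) F) ∈ permanentalIdeal F n := by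
  have hsum : (X (0, i) * X (0, j) * X (1, k) : MvPolynomial (Fin 2 × Fin n) F) =
      C (1 / 2) * (X (0, j) * (X (0, i) * X (1, k) + X (0, k) * X (1, i)) +
        X (0, i) * (X (0, j) * X (1, k) + X (0, k) * X (1, j)) -
        X (0, k) * (X (0, i) * X (1, j) + X (0, j) * X (1, i))) := by
    have h2 : (C (1 / 2) * 2 : MvPolynomial (Fin 2 × Fin n) F) = 1 := by
      rw [← map_ofNat C 2, ← map_mul]
      norm_num
    linear_combination (-(X (0, i) * X (0, j) * X (1, k))) * h2
  rw [hsum]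
  exact Ideal.mul_mem_left _ _ (sub_mem (add_mem
    (Ideal.mul_mem_left _ _ (permanent_mem_permanentalIdeal hik))
    (Ideal.mul_mem_left _ _ (permanent_mem_permanentalIdeal hjk)))
    (Ideal.mul_mem_left _ _ (permanent_mem_permanentalIdeal hij)))

theorem le_height_of_permanentalIdeal_le [CharZero F] (hn : 3 ≤ n)
    (p : Ideal (MvPolynomial (Fin 2 × Fin n) F)) [hp : p.IsPrime]
    (hI : permanentalIdeal F n ≤ p) : (n : ℕ∞) ≤ p.height := by
  by_cases h0 : ∀ j, X (0, j) ∈ p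
  · exact le_height_of_row_mem p 0 h0
  by_cases h1 : ∀ j, X (1, j) ∈ p
  · exact le_height_of_row_mem p 1 h1
  push Not at h0 h1
  obtain ⟨i, hi0⟩ := h0
  obtain ⟨l, hl1⟩ := h1
  have hi1 : X (1, i) ∉ p := fun h => by
    have hil : i ≠ l := by rintro rfl; exact hl1 h
    have hf := hI (permanent_mem_permanentalIdeal hil)
    rw [p.add_mem_iff_left (p.mul_mem_left _ h)] at hf
    exact (hp.mem_or_mem hf).elim hi0 hl1
  have hcol := X_zero_mem_iff_X_one_mem hI hi0 hi1
  obtain ⟨j, hij, hj⟩ : ∃ j, i ≠ j ∧ ∀ k, k ≠ i → k ≠ j → X (1, k) ∈ p := by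
    by_cases hex : ∃ j, i ≠ j ∧ X (0, j) ∉ p
    · obtain ⟨j, hij, hj0⟩ := hex
      refine ⟨j, hij, fun k hki hkj => ?_⟩
      have hmem := hI (X_mul_X_mul_X_mem_permanentalIdeal hij hki.symm hkj.symm)
      exact (hp.mem_or_mem hmem).resolve_left fun h => (hp.mem_or_mem h).elim hi0 hj0
    · push Not at hex
      have : Nontrivial (Fin n) := Fin.nontrivial_iff_two_le.mpr (by omega)
      obtain ⟨j, hj⟩ := exists_ne i
      exact ⟨j, hj.symm, fun k hki _ => (hcol k).mp (hex k hki.symm)⟩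
  refine le_trans (by exact_mod_cast (by omega : n ≤ 2 * (n - 2) + 1))
    (le_height_of_columns_mem hI hij fun r k hki hkj => ?_)
  fin_cases r
  · exact (hcol k).mpr (hj k hki hkj)
  · exact hj k hki hkj

end PermanentalIdeal

/-- The variety `P_{2,n} = {prk(M) ≤ 1}` has codimension `n` in `F^{2×n}`:
the ideal of `2 × 2` permanents of the generic `2 × n` matrix has height `n`. -/
theorem statement0 (F : Type*) [Field F] [CharZero F] (n : ℕ) (hn : 3 ≤ n) :
    idealHeight (permanentalIdeal F n) = (n : ℕ∞) := by
  refine le_antisymm ?_ (le_iInf₂ fun p hp => ?_)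
  · refine (iInf₂_le (⟨_, isPrime_span_X_image _⟩ : PrimeSpectrum _)
      permanentalIdeal_le_span_second_row).trans ?_
    rw [← PrimeSpectrum.height_eq_orderHeight]
    refine (height_span_X_image_le_card _).trans ?_
    exact_mod_cast Finset.card_image_le.trans (Finset.card_fin n).le
  · rw [← PrimeSpectrum.height_eq_orderHeight]
    exact le_height_of_permanentalIdeal_le hn p.asIdeal hp

end
end

section
/- Let F be a field with char F ≠ 2 and let n ≥ 3. Suppose x_0, x_1, …, x_n ∈ F satisfy x_i·x_{j+1} + x_j·x_{i+1} = 0 for all 0 ≤ i < j ≤ n−1 (i.e., all 2×2 permanents of the 2×n Hankel matrix with first row (x_0,…,x_{n−1}) and second row (x_1,…,x_n) vanish). Then either x_1 = x_2 = ⋯ = x_n = 0 or x_0 = x_1 = ⋯ = x_{n−1} = 0. In other words, the projective zero set of the 2×2 permanents of the Hankel matrix is supported at the two coordinate points [1:0:⋯:0] and [0:⋯:0:1]. -/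
/-- If the three `2 × 2` permanents of the `2 × 3` Hankel matrix on `a, b, c, d` vanish and
`2 ≠ 0`, then both middle entries vanish. -/
theorem hankel_middle_eq_zero {F : Type*} [Field F] (h2 : (2 : F) ≠ 0) {a b c d : F}
    (h₀₁ : a * c + b * b = 0) (h₀₂ : a * d + c * b = 0) (h₁₂ : b * d + c * c = 0) :
    b = 0 ∧ c = 0 := by
  have h : (2 : F) * (b * c) ^ 2 = 0 := by
    linear_combination c ^ 2 * h₀₁ - a * c * h₁₂ + b * c * h₀₂
  have hbc : b * c = 0 := by simpa [h2] using h
  rcases mul_eq_zero.mp hbc with rfl | rfl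
  · exact ⟨rfl, by simpa using h₁₂⟩
  · exact ⟨by simpa using h₀₁, rfl⟩


/-- If all `2 × 2` permanents of the `2 × n` Hankel matrix with rows
`(x_0, …, x_{n-1})` and `(x_1, …, x_n)` vanish (and `char F ≠ 2`, `n ≥ 3`), then either
`x_1 = ⋯ = x_n = 0` or `x_0 = ⋯ = x_{n-1} = 0`; i.e. the projective zero set of these
permanents is supported at the two coordinate points `[1:0:⋯:0]` and `[0:⋯:0:1]`. -/
theorem statement1 (F : Type*) [Field F] (hF : ringChar F ≠ 2) (n : ℕ) (hn : 3 ≤ n)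
    (x : Fin (n + 1) → F)
    (hperm : ∀ i j : Fin n, i < j →
      x i.castSucc * x j.succ + x j.castSucc * x i.succ = 0) :
    (∀ i : Fin n, x i.succ = 0) ∨ (∀ i : Fin n, x i.castSucc = 0) := by
  have h2 : (2 : F) ≠ 0 := Ring.two_ne_zero hF
  have hp : ∀ i j : ℕ, ∀ hij : i < j, ∀ hj : j < n,
      x ⟨i, by omega⟩ * x ⟨j + 1, by omega⟩ + x ⟨j, by omega⟩ * x ⟨i + 1, by omega⟩ = 0 :=
    fun i j hij hj => hperm ⟨i, by omega⟩ ⟨j, hj⟩ hij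
  have window : ∀ k : ℕ, ∀ hk : k + 3 ≤ n,
      x ⟨k + 1, by omega⟩ = 0 ∧ x ⟨k + 2, by omega⟩ = 0 := fun k hk =>
    hankel_middle_eq_zero h2 (hp k (k + 1) (by omega) (by omega))
      (hp k (k + 2) (by omega) (by omega)) (hp (k + 1) (k + 2) (by omega) (by omega))
  have interior : ∀ k : ℕ, ∀ hk : k + 1 < n, x ⟨k + 1, by omega⟩ = 0 := by
    intro k hk
    by_cases h : k + 3 ≤ n
    · exact (window k h).1
    · obtain ⟨m, rfl⟩ : ∃ m, k = m + 1 := ⟨k - 1, by omega⟩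
      exact (window m (by omega)).2
  obtain ⟨m, rfl⟩ : ∃ m, n = m + 1 := ⟨n - 1, by omega⟩
  have hends : x ⟨0, by omega⟩ * x ⟨m + 1, by omega⟩ = 0 := by
    linear_combination hp 0 m (by omega) (by omega) -
      x ⟨m, by omega⟩ * interior 0 (by omega)
  rcases mul_eq_zero.mp hends with h | h
  · right
    rintro ⟨_ | k, hk⟩
    · exact h
    · exact interior k hk
  · left
    rintro ⟨k, hk⟩
    rcases Nat.lt_succ_iff_lt_or_eq.mp hk with hlt | rfl
    · exact interior k (by omega)
    · exact h
end

section
/- Let F be a field with char F ≠ 2 and let n ≥ 3. Let J ⊆ F[x_0,…,x_{n−1}] be the ideal generated by the 2×2 permanents of the 2×n matrix with first row (x_0, x_1, …, x_{n−1}) and second row (x_1, …, x_{n−1}, 1), i.e., the dehomogenization at x_n = 1 of the 2×2 permanents of the Hankel matrix. Then the quotient ring F[x_0,…,x_{n−1}]/J is a 4-dimensional vector space over F (with basis the images of 1, x_{n−3}, x_{n−2}, x_{n−1}). In particular, this dimension does not depend on n. -/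
open MvPolynomial

noncomputable section

/-- The entries of the Hankel matrix dehomogenized at `x_n = 1`:
`hankelVar F n i = x_i` for `i < n` and `= 1` for `i = n`. -/
def hankelVar (F : Type*) [Field F] (n : ℕ) (i : Fin (n + 1)) : MvPolynomial (Fin n) F :=
  if h : i.val < n then X ⟨i.val, h⟩ else 1

/-- The ideal generated by the `2 × 2` permanents of the `2 × n` matrix with first row
`(x_0, …, x_{n-1})` and second row `(x_1, …, x_{n-1}, 1)` (the dehomogenization at `x_n = 1`
of the `2 × 2` permanents of the Hankel matrix). -/
def hankelPermIdeal (F : Type*) [Field F] (n : ℕ) : Ideal (MvPolynomial (Fin n) F) :=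
  Ideal.span { p | ∃ i j : Fin n, i < j ∧
    p = hankelVar F n i.castSucc * hankelVar F n j.succ
      + hankelVar F n j.castSucc * hankelVar F n i.succ }

/-- In a quotient by the Hankel permanents, the image of the variable `x_{n-k}`. -/
def hankelCoord (F : Type*) [Field F] (n k : ℕ) :
    MvPolynomial (Fin n) F ⧸ hankelPermIdeal F n :=
  Ideal.Quotient.mkₐ F _ (hankelVar F n ⟨n - k, by omega⟩)

lemma hankelCoord_zero (F : Type*) [Field F] (n : ℕ) : hankelCoord F n 0 = 1 := by
  simp [hankelCoord, hankelVar]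

lemma hankelCoord_of_val (F : Type*) [Field F] (n : ℕ) (i : Fin n) :
    hankelCoord F n (n - i.val) = Ideal.Quotient.mkₐ F _ (X i) := by
  have h : n - (n - i.val) = i.val := by omega
  simp [hankelCoord, hankelVar, h]

lemma hankelCoord_rel (F : Type*) [Field F] {n k l : ℕ} (hkl : k < l) (hl : l < n) :
    hankelCoord F n (l + 1) * hankelCoord F n k
      + hankelCoord F n (k + 1) * hankelCoord F n l = 0 := by
  simp only [hankelCoord, ← map_mul, ← map_add]
  refine Ideal.Quotient.eq_zero_iff_mem.mpr (Ideal.subset_span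
    ⟨⟨n - (l + 1), by omega⟩, ⟨n - (k + 1), by omega⟩, Fin.mk_lt_mk.mpr (by omega), ?_⟩)
  have h1 : n - (l + 1) + 1 = n - l := by omega
  have h2 : n - (k + 1) + 1 = n - k := by omega
  simp only [Fin.castSucc_mk, Fin.succ_mk, h1, h2]

lemma hankelCoord_succ (F : Type*) [Field F] {n k : ℕ} (hk : k < n) :
    hankelCoord F n (k + 1) = -(-hankelCoord F n 1) ^ (k + 1) := by
  induction k with
  | zero => simp
  | succ k ih =>
    have h := hankelCoord_rel F (Nat.succ_pos k) hk
    rw [hankelCoord_zero, mul_one, zero_add, ih (by omega)] at h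
    rw [eq_neg_of_add_eq_zero_left h, pow_succ _ (k + 1)]
    ring

lemma hankelCoord_one_pow_four (F : Type*) [Field F] (hF : ringChar F ≠ 2) {n : ℕ}
    (hn : 3 ≤ n) : hankelCoord F n 1 ^ 4 = 0 := by
  have h := hankelCoord_rel F (n := n) (k := 1) (l := 2) (by omega) (by omega)
  rw [hankelCoord_succ F (k := 2) (by omega), hankelCoord_succ F (k := 1) (by omega)] at h
  have h2 : (2 : F) • hankelCoord F n 1 ^ 4 = 0 := by
    rw [two_smul]
    linear_combination h
  exact (smul_eq_zero.mp h2).resolve_left (Ring.two_ne_zero hF)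

/-- The evaluation `x_i ↦ -u ^ (n - i)`. -/
def hankelEval (F : Type*) [Field F] (n : ℕ) {A : Type*} [CommRing A] [Algebra F A] (u : A) :
    MvPolynomial (Fin n) F →ₐ[F] A :=
  aeval fun i => -u ^ (n - i.val)

lemma hankelEval_hankelVar (F : Type*) [Field F] (n : ℕ) {A : Type*} [CommRing A]
    [Algebra F A] (u : A) (i : Fin (n + 1)) :
    hankelEval F n u (hankelVar F n i) = if i.val < n then -u ^ (n - i.val) else 1 := by
  unfold hankelVar hankelEval
  split_ifs <;> simp

lemma hankelEval_eq_zero (F : Type*) [Field F] (n : ℕ) {A : Type*} [CommRing A]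
    [Algebra F A] {u : A} (hu : u ^ 4 = 0) :
    ∀ p ∈ hankelPermIdeal F n, hankelEval F n u p = 0 := by
  suffices h : hankelPermIdeal F n ≤ RingHom.ker (hankelEval F n u) from fun p hp => h hp
  refine Ideal.span_le.mpr ?_
  rintro _ ⟨i, j, hij, rfl⟩
  have hij' : i.val < j.val := hij
  have hj := j.isLt
  have hi := i.isLt
  simp only [SetLike.mem_coe, RingHom.mem_ker, map_add, map_mul, hankelEval_hankelVar,
    Fin.val_castSucc, Fin.val_succ, hj, hi, if_true, show i.val + 1 < n by omega]
  split_ifs with h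
  · obtain ⟨d, hd⟩ : ∃ d, n - i.val + (n - (j.val + 1)) = 4 + d :=
      Nat.exists_eq_add_of_le (by omega)
    obtain ⟨e, he⟩ : ∃ e, n - j.val + (n - (i.val + 1)) = 4 + e :=
      Nat.exists_eq_add_of_le (by omega)
    rw [neg_mul_neg, neg_mul_neg, ← pow_add, ← pow_add, hd, he, pow_add, pow_add, hu]
    ring
  · have h1 : n - j.val = 1 := by omega
    have h2 : n - i.val = n - (i.val + 1) + 1 := by omega
    rw [h1, h2]
    ring

lemma adjoinRoot_X_pow_root_pow (F : Type*) [Field F] (m : ℕ) :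
    AdjoinRoot.root (Polynomial.X ^ m : Polynomial F) ^ m = 0 := by
  rw [← AdjoinRoot.mk_X, ← map_pow, AdjoinRoot.mk_self]

lemma eval₂_neg_hankelCoord_one (F : Type*) [Field F] (hF : ringChar F ≠ 2) {n : ℕ}
    (hn : 3 ≤ n) :
    (Polynomial.X ^ 4 : Polynomial F).eval₂
      (Algebra.ofId F (MvPolynomial (Fin n) F ⧸ hankelPermIdeal F n))
      (-hankelCoord F n 1) = 0 := by
  rw [Polynomial.eval₂_X_pow]
  exact (Even.neg_pow (by decide) _).trans (hankelCoord_one_pow_four F hF hn)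

/-- The quotient by the dehomogenized Hankel permanents is `F[T] / (T ^ 4)`. -/
def hankelQuotientEquiv (F : Type*) [Field F] (hF : ringChar F ≠ 2) (n : ℕ) (hn : 3 ≤ n) :
    (MvPolynomial (Fin n) F ⧸ hankelPermIdeal F n) ≃ₐ[F]
      AdjoinRoot (Polynomial.X ^ 4 : Polynomial F) :=
  AlgEquiv.ofAlgHom
    (Ideal.Quotient.liftₐ _ (hankelEval F n (AdjoinRoot.root (Polynomial.X ^ 4)))
      (hankelEval_eq_zero F n (adjoinRoot_X_pow_root_pow F 4)))
    (AdjoinRoot.liftAlgHom _ (Algebra.ofId F _) (-hankelCoord F n 1)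
      (eval₂_neg_hankelCoord_one F hF hn))
    (by
      refine AdjoinRoot.algHom_ext ?_
      have h : n - (n - 1) = 1 := by omega
      simp only [AlgHom.comp_apply, AdjoinRoot.liftAlgHom_root, map_neg, AlgHom.id_apply]
      change -hankelEval F n _ (hankelVar F n _) = _
      simp [hankelEval_hankelVar, h, show 0 < n by omega])
    (by
      refine Ideal.Quotient.algHom_ext _ (MvPolynomial.algHom_ext fun i => ?_)
      have h := hankelCoord_succ F (n := n) (k := n - i.val - 1) (by omega)
      rw [show n - i.val - 1 + 1 = n - i.val by omega, hankelCoord_of_val] at h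
      change AdjoinRoot.liftAlgHom _ _ _ (eval₂_neg_hankelCoord_one F hF hn) (hankelEval F n _ (X i)) = _
      rw [hankelEval, aeval_X, map_neg, map_pow, AdjoinRoot.liftAlgHom_root]
      exact h.symm)

/-- For `char F ≠ 2` and `n ≥ 3`, the quotient `F[x_0,…,x_{n-1}]/J` by the dehomogenized
`2 × 2` Hankel permanents is a `4`-dimensional `F`-vector space; in particular the
dimension does not depend on `n`. -/
theorem statement2 (F : Type*) [Field F] (hF : ringChar F ≠ 2) (n : ℕ) (hn : 3 ≤ n) :
    Module.rank F (MvPolynomial (Fin n) F ⧸ hankelPermIdeal F n) = 4 := by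
  have hmonic : (Polynomial.X ^ 4 : Polynomial F).Monic := Polynomial.monic_X_pow 4
  rw [(hankelQuotientEquiv F hF n hn).toLinearEquiv.rank_eq,
    rank_eq_card_basis (AdjoinRoot.powerBasis' hmonic).basis]
  simp

end
end

section
/- Let F be an arbitrary field and k ≥ 2. Let S_k ⊆ MvPolynomial (Fin k × Fin k) F be the ideal generated by the permanents of all (k−1)×(k−1) submatrices of the generic k×k matrix. Then Ideal.height S_k ≥ 4; equivalently, the singular locus Sing(P) = {prk(M) ≤ k−2} of the permanental hypersurface has codimension at least 4 in F^{k×k}. -/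
open MvPolynomial

noncomputable section

/-- The ideal `S_k` generated by the permanents of all `(k-1) × (k-1)` submatrices of the
generic `k × k` matrix, the rows and columns being selected by strictly monotone maps
`Fin (k-1) → Fin k`. Its vanishing locus is the singular locus of the permanental
hypersurface. -/
def singularIdeal (F : Type*) [Field F] (k : ℕ) : Ideal (MvPolynomial (Fin k × Fin k) F) :=
  Ideal.span { p | ∃ r c : Fin (k - 1) → Fin k, StrictMono r ∧ StrictMono c ∧
    p = perm (Matrix.of fun a b => X (r a, c b)) }

/-- The height of a prime ideal does not drop under extension to the polynomial ring. -/
theorem Polynomial.height_le_height_map_C {R : Type*} [CommRing R] (p : Ideal R) [hp : p.IsPrime] :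
    p.height ≤ (p.map (Polynomial.C : R →+* Polynomial R)).height := by
  let g : PrimeSpectrum R → PrimeSpectrum (Polynomial R) := fun q =>
    ⟨q.asIdeal.map Polynomial.C, (Ideal.isPrime_map_C_iff_isPrime _).2 q.2⟩
  have hg : StrictMono g := by
    refine Monotone.strictMono_of_injective (fun a b h => Ideal.map_mono h) fun a b h => ?_
    ext x
    have := congrArg (fun q : PrimeSpectrum (Polynomial R) => Polynomial.C x ∈ q.asIdeal) h
    simpa [g, Ideal.mem_map_C_iff, Polynomial.coeff_C, apply_ite, Ideal.zero_mem] using this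
  have h := Order.height_le_height_apply_of_strictMono g hg ⟨p, hp⟩
  rwa [← PrimeSpectrum.height_eq_orderHeight, ← PrimeSpectrum.height_eq_orderHeight] at h

/-- Modulo a prime ideal of height at most `h` in a polynomial ring over a field, all but `h` of
the variables can be chosen algebraically independent. -/
theorem MvPolynomial.exists_finset_algebraicIndependent_of_height_le (F : Type*) [Field F]
    (σ : Type*) [Finite σ] (P : Ideal (MvPolynomial σ F)) [P.IsPrime] (h : ℕ)
    (hP : P.height ≤ h) :
    ∃ T : Finset σ, Nat.card σ ≤ T.card + h ∧
      ∀ f ∈ P, (∀ m ∈ f.support, m.support ⊆ T) → f = 0 := by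
  induction σ using Finite.induction_empty_option generalizing h with
  | @of_equiv α β e ih =>
    classical
    let φ := (renameEquiv F e).toRingEquiv
    obtain ⟨T, hT, hTP⟩ := ih (P.comap φ) h (by rwa [φ.height_comap])
    refine ⟨T.map e.toEmbedding, by simpa [Nat.card_congr e] using hT, fun f hf hfT => ?_⟩
    have key := hTP (φ.symm f) (by
      rw [Ideal.mem_comap]
      simpa only [φ.apply_symm_apply] using hf) (by
      intro m hm
      have hs : φ.symm f = rename e.symm f := rfl
      rw [hs, support_rename_of_injective e.symm.injective, Finset.mem_image] at hm
      obtain ⟨m', hm', rfl⟩ := hm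
      intro i hi
      have h1 : e i ∈ m'.support := by
        rw [Finsupp.mem_support_iff] at hi ⊢
        rwa [show i = e.symm (e i) by simp,
          Finsupp.mapDomain_apply e.symm.injective] at hi
      simpa using hfT m' hm' h1)
    simpa using key
  | h_empty =>
    refine ⟨∅, by simp, fun f hf _ => ?_⟩
    by_contra hne
    refine Ideal.IsPrime.ne_top ‹P.IsPrime› (Ideal.eq_top_of_isUnit_mem _ hf ?_)
    rw [eq_C_of_isEmpty f] at hne ⊢
    exact (IsUnit.mk0 _ fun h0 => hne (by rw [h0, C_0])).map C
  | @h_option α _ ih =>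
    let φ := (optionEquivLeft F α).toRingEquiv
    let Q := P.comap φ.symm
    let p := Q.comap Polynomial.C
    have hQ : Q.height ≤ h := by rwa [RingEquiv.height_comap]
    have hpQ : p.map Polynomial.C ≤ Q := Ideal.map_comap_le
    have hmem : ∀ f, f ∈ P ↔ φ f ∈ Q := fun f => by simp [Q]
    have hcoeff : ∀ f : MvPolynomial (Option α) F, ∀ i, ∀ m ∈ ((φ f).coeff i).support,
        m.optionElim i ∈ f.support := fun f i m hm =>
      (mem_support_coeff_optionEquivLeft F).1 hm
    obtain heq | hne := eq_or_ne (p.map Polynomial.C) Q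
    · obtain ⟨T, hT, hTp⟩ := ih p h
        (((Polynomial.height_le_height_map_C p).trans (Ideal.height_mono hpQ)).trans hQ)
      refine ⟨T.insertNone, ?_, fun f hf hfT => ?_⟩
      · rw [Finite.card_option, Finset.card_insertNone]
        omega
      · rw [hmem, ← heq, Ideal.mem_map_C_iff] at hf
        refine φ.injective (Polynomial.ext fun i => ?_)
        rw [map_zero, Polynomial.coeff_zero]
        refine hTp _ (hf i) fun m hm j hj => ?_
        have := hfT _ (hcoeff f i m hm) (show some j ∈ (m.optionElim i).support by simpa using hj)
        simpa using this
    · have hpr : (p.map Polynomial.C).IsPrime := (Ideal.isPrime_map_C_iff_isPrime p).2 inferInstance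
      have hlt := Ideal.height_add_one_le_of_lt_of_isPrime (lt_of_le_of_ne hpQ hne)
      have hph : p.height + 1 ≤ h :=
        (add_le_add_left (Polynomial.height_le_height_map_C p) 1).trans (hlt.trans hQ)
      obtain ⟨h, rfl⟩ : ∃ h', h = h' + 1 := by
        refine Nat.exists_eq_succ_of_ne_zero fun h0 => ?_
        simp [h0] at hph
      obtain ⟨T, hT, hTp⟩ := ih p h (by
        push_cast at hph
        exact (ENat.add_le_add_iff_right ENat.one_ne_top).1 hph)
      refine ⟨T.map Function.Embedding.some, ?_, fun f hf hfT => ?_⟩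
      · rw [Finite.card_option, Finset.card_map]
        omega
      · have hC : φ f = Polynomial.C ((φ f).coeff 0) := by
          refine Polynomial.ext fun i => ?_
          rw [Polynomial.coeff_C]
          split_ifs with hi
          · rw [hi]
          · by_contra h0
            obtain ⟨m, hm⟩ := support_nonempty.2 h0
            have := hfT _ (hcoeff f i m hm)
              (show none ∈ (m.optionElim i).support by simpa using hi)
            simp at this
        have h0 : (φ f).coeff 0 = 0 := by
          refine hTp _ ?_ fun m hm j hj => ?_
          · rw [Ideal.mem_comap, ← hC]
            exact (hmem f).1 hf
          · have := hfT _ (hcoeff f 0 m hm)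
              (show some j ∈ (m.optionElim 0).support by simpa using hj)
            simpa using this
        exact φ.injective (by rw [hC, h0, map_zero, map_zero])

/-- If modulo `I` every monomial is a combination of monomials that have no larger degree and
involve at most `r` variables each, then `I` has codimension at least `card σ - r`. -/
theorem MvPolynomial.card_le_height_add_of_monomial_mem {F : Type*} [Field F] {σ : Type*}
    [Fintype σ] (I : Ideal (MvPolynomial σ F)) (r : ℕ)
    (hI : ∀ m : σ →₀ ℕ, monomial m 1 ∈ I.restrictScalars F ⊔
      restrictSupport F {s | s.support.card ≤ r ∧ s.degree ≤ m.degree}) :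
    (Fintype.card σ : ℕ∞) ≤ I.height + r := by
  classical
  rw [Ideal.height_eq_inf_minimalPrimes]
  by_contra! hlt
  obtain ⟨P, hPmin, hP⟩ : ∃ P ∈ I.minimalPrimes, P.height + r < Fintype.card σ := by
    by_contra! hall
    refine hlt.not_ge ?_
    rw [ENat.iInf_add]
    refine le_iInf fun P => ?_
    by_cases hPm : P ∈ I.minimalPrimes
    · simpa [hPm] using hall P hPm
    · simp [hPm]
  have := hPmin.isPrime
  obtain ⟨h, hh⟩ := ENat.ne_top_iff_exists.1 (fun ht : P.height = ⊤ => by simp [ht] at hP)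
  rw [← hh] at hP
  norm_cast at hP
  obtain ⟨T, hT, hTP⟩ := exists_finset_algebraicIndependent_of_height_le F σ P h hh.ge
  rw [Nat.card_eq_fintype_card] at hT
  set N := Fintype.card σ
  have count : ∀ e : ℕ, (e + 1) ^ T.card ≤ 2 ^ N * (N * e + 1) ^ r := by
    intro e
    let A : Finset (σ →₀ ℕ) := T.finsupp fun _ => Finset.range (e + 1)
    let B : Finset (σ →₀ ℕ) := (Finset.univ.filter fun U : Finset σ => U.card ≤ r).biUnion
      fun U => U.finsupp fun _ => Finset.range (N * e + 1)
    let π : MvPolynomial σ F →ₗ[F] MvPolynomial σ F ⧸ P := (Ideal.Quotient.mkₐ F P).toLinearMap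
    have hA : A.card = (e + 1) ^ T.card := by simp [A, Finset.card_finsupp]
    have hB : B.card ≤ 2 ^ N * (N * e + 1) ^ r := by
      refine (Finset.card_biUnion_le_card_mul _ _ ((N * e + 1) ^ r) fun U hU => ?_).trans ?_
      · rw [Finset.card_finsupp]
        simpa using Nat.pow_le_pow_right (Nat.succ_pos _) (Finset.mem_filter.1 hU).2
      · refine Nat.mul_le_mul_right _ ((Finset.card_filter_le _ _).trans ?_)
        simp [N]
    have hli : LinearIndependent F fun a : A => π (monomial a.1 1) := by
      have h1 : LinearIndependent F fun a : A => (monomial a.1 (1 : F)) := by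
        simpa [Function.comp_def] using (basisMonomials σ F).linearIndependent.comp
          (fun a : A => a.1) Subtype.val_injective
      refine h1.map (f := π) ?_
      rw [Submodule.disjoint_def]
      intro f hf hfk
      have hfA : f ∈ restrictSupport F (A : Set (σ →₀ ℕ)) := by
        refine Submodule.span_le.2 ?_ hf
        rintro _ ⟨a, rfl⟩
        exact (monomial_mem_restrictSupport F).2 (Or.inl a.2)
      refine hTP f (Ideal.Quotient.eq_zero_iff_mem.1 hfk) fun m hm => ?_
      exact (Finset.mem_finsupp_iff.1 ((mem_restrictSupport_iff F).1 hfA hm)).1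
    have hle := linearIndependent_le_span_aux' _ hli
      ((B.image fun s => π (monomial s 1) : Finset _) : Set (MvPolynomial σ F ⧸ P)) (by
      rintro _ ⟨a, rfl⟩
      have ha := Finset.mem_finsupp_iff.1 a.2
      have hdeg : a.1.degree ≤ N * e := by
        rw [Finsupp.degree_eq_sum]
        refine (Finset.sum_le_card_nsmul Finset.univ _ e fun i _ => ?_).trans (by simp [N])
        by_cases hi : i ∈ T
        · exact Nat.lt_succ_iff.1 (Finset.mem_range.1 (ha.2 i hi))
        · rw [Finsupp.notMem_support_iff.1 fun h => hi (ha.1 h)]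
          exact Nat.zero_le _
      obtain ⟨x, hx, y, hy, hxy⟩ := Submodule.mem_sup.1 (hI a.1)
      have hπx : π x = 0 := Ideal.Quotient.eq_zero_iff_mem.2 (hPmin.1.2 hx)
      change π (monomial a.1 1) ∈ _
      rw [← hxy, map_add, hπx, zero_add]
      rw [restrictSupport_eq_span] at hy
      have := Submodule.mem_map_of_mem (f := π) hy
      rw [Submodule.map_span] at this
      refine Submodule.span_mono ?_ this
      rintro _ ⟨_, ⟨s, hs, rfl⟩, rfl⟩
      refine Finset.mem_coe.2 (Finset.mem_image_of_mem _ (Finset.mem_biUnion.2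
        ⟨s.support, by simpa using hs.1, Finset.mem_finsupp_iff.2 ⟨subset_rfl, fun i _ => ?_⟩⟩))
      exact Finset.mem_range.2 (Nat.lt_succ_iff.2
        ((Finsupp.le_degree i s).trans (hs.2.trans hdeg))))
    rw [Fintype.card_coe, hA] at hle
    refine hle.trans (le_trans ?_ hB)
    exact (Fintype.card_coe _).trans_le Finset.card_image_le
  have hN : 0 < N := by omega
  set e := 2 ^ N * N ^ r with he
  have h1 : (e + 1) ^ (r + 1) ≤ (e + 1) ^ T.card := Nat.pow_le_pow_right (Nat.succ_pos _) (by omega)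
  have h2 : (N * e + 1) ^ r ≤ N ^ r * (e + 1) ^ r := by
    rw [← Nat.mul_pow]
    exact Nat.pow_le_pow_left (by nlinarith) r
  have h3 : (e + 1) ^ (r + 1) ≤ e * (e + 1) ^ r := by
    calc (e + 1) ^ (r + 1) ≤ 2 ^ N * (N * e + 1) ^ r := h1.trans (count e)
      _ ≤ 2 ^ N * (N ^ r * (e + 1) ^ r) := Nat.mul_le_mul_left _ h2
      _ = e * (e + 1) ^ r := by rw [he, mul_assoc]
  have h4 : 0 < (e + 1) ^ r := by positivity
  rw [pow_succ'] at h3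
  exact absurd (Nat.le_of_mul_le_mul_right h3 h4) (by omega)

/-- Among the rearrangements of two strictly increasing sequences, the identity is the only one
that maximizes the sum of products. -/
theorem sum_mul_comp_perm_lt_of_strictMono {n : ℕ} {f g : Fin n → ℕ} (hf : StrictMono f)
    (hg : StrictMono g) {τ : Equiv.Perm (Fin n)} (hτ : τ ≠ 1) :
    ∑ i, f i * g (τ i) < ∑ i, f i * g i := by
  rw [(hf.monotone.monovary hg.monotone).sum_mul_comp_perm_lt_sum_mul_iff]
  intro hmono
  have hs : StrictMono τ.symm := by
    refine Monotone.strictMono_of_injective (fun i j hij => ?_) τ.symm.injective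
    obtain rfl | hlt := hij.eq_or_lt
    · rfl
    · exact hf.le_iff_le.1 (hmono (by simpa using hg hlt))
  refine hτ (inv_eq_one.1 (Equiv.coe_fn_injective ?_))
  exact (hs.range_inj strictMono_id).1 (by simp [τ.symm.surjective.range_eq])

/-- A monomial divisible by none of the diagonals of the `n × n` submatrices of an
`(n + 1) × (n + 1)` matrix misses at least four of the variables. -/
theorem card_support_add_four_le_of_diagonal {n : ℕ}
    (s : Fin (n + 1) × Fin (n + 1) →₀ ℕ)
    (hs : ∀ r c : Fin n → Fin (n + 1), StrictMono r → StrictMono c → ∃ a, s (r a, c a) = 0) :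
    s.support.card + 4 ≤ (n + 1) * (n + 1) := by
  obtain ⟨a, ha⟩ := hs _ _ (Fin.strictMono_succ) (Fin.strictMono_castSucc)
  obtain ⟨b, hb⟩ := hs _ _ (Fin.strictMono_castSucc) (Fin.strictMono_succ)
  obtain ⟨i, hi⟩ := hs _ _ (Fin.strictMono_succ) (Fin.strictMono_succ)
  obtain ⟨j, hj⟩ := hs _ _ (Fin.strictMono_succAbove i.succ) (Fin.strictMono_succAbove i.succ)
  have hij := Fin.succAbove_ne i.succ j
  set i' := i.succ
  set j' := i'.succAbove j
  have hcard : ({(a.succ, a.castSucc), (b.castSucc, b.succ), (i', i'), (j', j')} :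
      Finset (Fin (n + 1) × Fin (n + 1))).card = 4 := by
    rw [Finset.card_insert_of_notMem, Finset.card_insert_of_notMem, Finset.card_insert_of_notMem,
      Finset.card_singleton] <;>
      simp only [Finset.mem_insert, Finset.mem_singleton, Prod.mk.injEq, Fin.ext_iff, Fin.val_succ,
        Fin.val_castSucc] at hij ⊢ <;> omega
  have hsub : ({(a.succ, a.castSucc), (b.castSucc, b.succ), (i', i'), (j', j')} :
      Finset (Fin (n + 1) × Fin (n + 1))) ⊆ s.supportᶜ := by
    intro v hv
    simp only [Finset.mem_insert, Finset.mem_singleton] at hv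
    rw [Finset.mem_compl, Finsupp.notMem_support_iff]
    obtain rfl | rfl | rfl | rfl := hv <;> assumption
  have := Finset.card_le_card hsub
  have htot := Finset.card_add_card_compl s.support
  simp only [Fintype.card_prod, Fintype.card_fin] at htot
  omega

/-- Modulo `singularIdeal`, every monomial is a combination of monomials of the same degree that
are not divisible by the diagonal of any `n × n` submatrix. -/
theorem monomial_mem_singularIdeal_sup (F : Type*) [Field F] (n : ℕ)
    (m : Fin (n + 1) × Fin (n + 1) →₀ ℕ) :
    monomial m 1 ∈ (singularIdeal F (n + 1)).restrictScalars F ⊔ restrictSupport F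
      {s | (∀ r c : Fin n → Fin (n + 1), StrictMono r → StrictMono c → ∃ a, s (r a, c a) = 0) ∧
        s.degree = m.degree} := by
  let w : (Fin (n + 1) × Fin (n + 1) →₀ ℕ) →+ ℕ := Finsupp.weight fun v => v.1.val * v.2.val
  induction hk : w m using Nat.strong_induction_on generalizing m with
  | h k ih =>
  by_cases hm : ∀ r c : Fin n → Fin (n + 1), StrictMono r → StrictMono c → ∃ a, m (r a, c a) = 0
  · exact Submodule.mem_sup_right ((monomial_mem_restrictSupport F).2 (Or.inl ⟨hm, rfl⟩))
  push Not at hm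
  obtain ⟨r, c, hr, hc, hrc⟩ := hm
  let D : Equiv.Perm (Fin n) → (Fin (n + 1) × Fin (n + 1) →₀ ℕ) :=
    fun τ => ∑ a, Finsupp.single (r a, c (τ a)) 1
  have hDm : D 1 ≤ m := by
    intro v
    by_cases hv : ∃ a, (r a, c a) = v
    · obtain ⟨a, rfl⟩ := hv
      have : D 1 (r a, c a) = 1 := by
        rw [Finsupp.finsetSum_apply, Finset.sum_eq_single a] <;>
          simp +contextual [hr.injective.eq_iff]
      rw [this]
      exact Nat.one_le_iff_ne_zero.2 (hrc a)
    · push Not at hv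
      have : D 1 v = 0 := by
        simp [D, Finsupp.finsetSum_apply, hv]
      rw [this]
      exact Nat.zero_le _
  obtain ⟨q, rfl⟩ := exists_add_of_le hDm
  have hwD : ∀ τ, w (D τ) = ∑ a, (r a).val * (c (τ a)).val := fun τ => by
    simp [w, D, Finsupp.weight_single]
  have hdeg : ∀ τ, (D τ + q).degree = (D 1 + q).degree := fun τ => by simp [D]
  have hprod : ∀ τ, ∏ a, (X (r a, c (τ a)) : MvPolynomial _ F) = monomial (D τ) 1 := fun τ => by
    rw [monomial_sum_one]
    rfl
  have hperm : ∑ τ, monomial (D τ + q) (1 : F) ∈ singularIdeal F (n + 1) := by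
    have hgen : perm (Matrix.of fun a b => (X (r a, c b) : MvPolynomial _ F)) ∈
        singularIdeal F (n + 1) := Ideal.subset_span ⟨r, c, hr, hc, rfl⟩
    have := Ideal.mul_mem_right (monomial q 1) _ hgen
    simpa [perm, hprod, Finset.sum_mul, monomial_mul] using this
  rw [← Finset.add_sum_erase _ _ (Finset.mem_univ 1)] at hperm
  rw [eq_sub_of_add_eq (rfl : monomial (D 1 + q) (1 : F) + _ = _)]
  refine Submodule.sub_mem _ (Submodule.mem_sup_left hperm) (Submodule.sum_mem _ fun τ hτ => ?_)
  have hlt : w (D τ + q) < k := by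
    rw [← hk, map_add, map_add, hwD, hwD]
    exact Nat.add_lt_add_right
      (sum_mul_comp_perm_lt_of_strictMono hr hc (Finset.ne_of_mem_erase hτ)) _
  simpa only [hdeg τ] using ih _ hlt (D τ + q) rfl

/-- For an arbitrary field `F` and `k ≥ 2`, the singular locus of the permanental
hypersurface has codimension at least `4`: `Ideal.height S_k ≥ 4`. -/
theorem statement4 (F : Type*) [Field F] (k : ℕ) (hk : 2 ≤ k) :
    (4 : ℕ∞) ≤ idealHeight (singularIdeal F k) := by
  obtain ⟨n, rfl⟩ : ∃ n, k = n + 1 := ⟨k - 1, by omega⟩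
  have h4 : 4 ≤ (n + 1) * (n + 1) := by
    have hn : 1 ≤ n := by omega
    nlinarith
  have hheight := card_le_height_add_of_monomial_mem (singularIdeal F (n + 1))
    ((n + 1) * (n + 1) - 4) (by
      intro m
      refine sup_le_sup_left (restrictSupport_mono F ?_) _ (monomial_mem_singularIdeal_sup F n m)
      rintro s ⟨hs, hd⟩
      exact ⟨Nat.le_sub_of_add_le (card_support_add_four_le_of_diagonal s hs), hd.le⟩)
  refine le_iInf₂ fun p hp => ?_
  rw [← PrimeSpectrum.height_eq_orderHeight]
  refine le_trans ?_ (Ideal.height_mono hp)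
  refine (ENat.add_le_add_iff_right (ENat.natCast_ne_top ((n + 1) * (n + 1) - 4))).1 ?_
  refine le_trans (le_of_eq ?_) hheight
  rw [Fintype.card_prod, Fintype.card_fin]
  norm_cast
  omega

end
end

section
/- Let F be an arbitrary field and k ≥ 2. The permanent of the generic k×k matrix, i.e., the polynomial perm(M) = Σ_{σ ∈ Sym(Fin k)} Π_i X(i, σ i) in MvPolynomial (Fin k × Fin k) F, is an irreducible polynomial. -/
open MvPolynomial

noncomputable section

/-- The homomorphism multiplying the variables in `S` by a new variable, so that the degree of the
image is the total degree in the variables of `S`. -/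
def gradeBy {σ : Type*} (R : Type*) [CommRing R] (S : Set σ) [DecidablePred (· ∈ S)] :
    MvPolynomial σ R →ₐ[R] Polynomial (MvPolynomial σ R) :=
  aeval fun s => Polynomial.C (X s) * if s ∈ S then Polynomial.X else 1

section GradeBy

variable {σ R : Type*} [CommRing R] (S : Set σ) [DecidablePred (· ∈ S)]

theorem eval_one_gradeBy (f : MvPolynomial σ R) : (gradeBy R S f).eval 1 = f := by
  have h : ((Polynomial.aeval (1 : MvPolynomial σ R)).restrictScalars R).comp (gradeBy R S) =
      AlgHom.id R _ := by
    ext s : 1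
    by_cases hs : s ∈ S <;> simp [gradeBy, hs]
  simpa [Polynomial.aeval_def, Polynomial.eval₂_eq_eval_map] using DFunLike.congr_fun h f

theorem eval_zero_gradeBy (f : MvPolynomial σ R) :
    (gradeBy R S f).eval 0 = bind₁ (fun s => if s ∈ S then 0 else X s) f := by
  have h : ((Polynomial.aeval (0 : MvPolynomial σ R)).restrictScalars R).comp (gradeBy R S) =
      bind₁ (fun s => if s ∈ S then 0 else X s) := by
    ext s : 1
    by_cases hs : s ∈ S <;> simp [gradeBy, hs]
  simpa [Polynomial.aeval_def, Polynomial.eval₂_eq_eval_map] using DFunLike.congr_fun h f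

theorem gradeBy_ne_zero {f : MvPolynomial σ R} (hf : f ≠ 0) : gradeBy R S f ≠ 0 := by
  intro h
  have := eval_one_gradeBy S f
  simp_all

theorem natDegree_gradeBy_pos [Nontrivial R] {f : MvPolynomial σ R} {s : σ} (hs : s ∈ S)
    (hf : s ∈ f.vars) : 0 < (gradeBy R S f).natDegree := by
  classical
  by_contra! h
  have hC := Polynomial.eq_C_of_natDegree_le_zero h
  have h1 := eval_one_gradeBy S f
  have h0 := eval_zero_gradeBy S f
  rw [hC, Polynomial.eval_C] at h1 h0
  rw [← h1, h0] at hf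
  obtain ⟨t, -, ht⟩ := Finset.mem_biUnion.1 (vars_bind₁ _ _ hf)
  by_cases htS : t ∈ S
  · simp [htS] at ht
  · simp only [htS, if_false, vars_X, Finset.mem_singleton] at ht
    exact htS (ht ▸ hs)

/-- If `f * g` is nonzero of degree at most one in the variables of `S`, then `f` and `g` cannot
both involve variables of `S`. -/
theorem notMem_vars_of_natDegree_gradeBy_mul_le_one [IsDomain R] {f g : MvPolynomial σ R}
    (h0 : f * g ≠ 0) (h : (gradeBy R S (f * g)).natDegree ≤ 1) {s t : σ} (hs : s ∈ S) (ht : t ∈ S)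
    (hf : s ∈ f.vars) : t ∉ g.vars := by
  intro hg
  rw [map_mul, Polynomial.natDegree_mul (gradeBy_ne_zero S (left_ne_zero_of_mul h0))
    (gradeBy_ne_zero S (right_ne_zero_of_mul h0))] at h
  have := natDegree_gradeBy_pos S hs hf
  have := natDegree_gradeBy_pos S ht hg
  omega

end GradeBy

section GenericPermanent

variable (R : Type*) [CommRing R] {k : ℕ}

theorem natDegree_gradeBy_row_perm_le (i : Fin k) :
    (gradeBy R {s : Fin k × Fin k | s.1 = i}
      (perm (Matrix.of fun i j : Fin k => X (i, j)))).natDegree ≤ 1 := by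
  rw [perm, map_sum]
  refine Polynomial.natDegree_sum_le_of_forall_le _ _ fun σ _ => ?_
  have : gradeBy R {s : Fin k × Fin k | s.1 = i}
      (∏ i, Matrix.of (fun i j : Fin k => X (i, j)) i (σ i)) =
      Polynomial.C (∏ i, X (i, σ i)) * Polynomial.X := by
    simp [gradeBy, -mul_ite, Finset.prod_mul_distrib]
  rw [this]
  exact Polynomial.natDegree_C_mul_le _ _ |>.trans Polynomial.natDegree_X_le

theorem natDegree_gradeBy_col_perm_le (j : Fin k) :
    (gradeBy R {s : Fin k × Fin k | s.2 = j}
      (perm (Matrix.of fun i j : Fin k => X (i, j)))).natDegree ≤ 1 := by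
  rw [perm, map_sum]
  refine Polynomial.natDegree_sum_le_of_forall_le _ _ fun σ _ => ?_
  have : gradeBy R {s : Fin k × Fin k | s.2 = j}
      (∏ i, Matrix.of (fun i j : Fin k => X (i, j)) i (σ i)) =
      Polynomial.C (∏ i, X (i, σ i)) * Polynomial.X := by
    simp [gradeBy, -mul_ite, Finset.prod_mul_distrib, ← Equiv.eq_symm_apply]
  rw [this]
  exact Polynomial.natDegree_C_mul_le _ _ |>.trans Polynomial.natDegree_X_le

theorem coeff_perm_generic (σ : Equiv.Perm (Fin k)) :
    coeff (∑ i, Finsupp.single (i, σ i) 1)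
      (perm (Matrix.of fun i j : Fin k => (X (i, j) : MvPolynomial (Fin k × Fin k) R))) = 1 := by
  have hprod (τ : Equiv.Perm (Fin k)) :
      ∏ i, (X (i, τ i) : MvPolynomial (Fin k × Fin k) R) =
        monomial (∑ i, Finsupp.single (i, τ i) 1) 1 := by
    simp [X, monomial_sum_one]
  simp only [perm, Matrix.of_apply, hprod, coeff_sum, coeff_monomial]
  rw [Finset.sum_eq_single σ _ (by simp), if_pos rfl]
  intro τ _ hτ
  refine if_neg fun h => hτ (Equiv.ext fun i => ?_)
  have := DFunLike.congr_fun h (i, τ i)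
  by_contra hne
  have hne' : σ i ≠ τ i := Ne.symm hne
  simp [Finsupp.finsetSum_apply, Finsupp.single_apply, Prod.ext_iff, ite_and, hne'] at this

theorem mem_vars_perm_generic [Nontrivial R] (s : Fin k × Fin k) :
    s ∈ (perm (Matrix.of fun i j : Fin k =>
      (X (i, j) : MvPolynomial (Fin k × Fin k) R))).vars := by
  obtain ⟨i, j⟩ := s
  rw [mem_vars_iff_mem_support]
  refine ⟨_, mem_support_iff.2 ((coeff_perm_generic R (Equiv.swap i j)).trans_ne one_ne_zero), ?_⟩
  rw [Finsupp.mem_support_iff, Finsupp.finsetSum_apply]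
  refine (Finset.sum_pos' (fun _ _ => Nat.zero_le _) ⟨i, Finset.mem_univ _, ?_⟩).ne'
  simp

end GenericPermanent

theorem isUnit_of_vars_eq_empty {σ F : Type*} [Field F] {f : MvPolynomial σ F} (h0 : f ≠ 0)
    (h : f.vars = ∅) : IsUnit f := by
  rw [vars_eq_empty_iff_eq_C] at h
  rw [h] at h0 ⊢
  exact (isUnit_iff_ne_zero.2 fun h' => h0 (by simp [h'])).map C

/-- In a factorization of the generic permanent, a factor involving some variable involves all of
them, so that the cofactor is a unit. -/
theorem isUnit_right_of_perm_eq_mul {F : Type*} [Field F] {k : ℕ}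
    {f g : MvPolynomial (Fin k × Fin k) F} (h0 : f * g ≠ 0)
    (h : perm (Matrix.of fun i j : Fin k => (X (i, j) : MvPolynomial (Fin k × Fin k) F)) = f * g)
    {s : Fin k × Fin k} (hs : s ∈ f.vars) : IsUnit g := by
  classical
  have hrow (t : Fin k × Fin k) (ht : t.1 = s.1) : t ∈ f.vars := by
    have hg := notMem_vars_of_natDegree_gradeBy_mul_le_one {u : Fin k × Fin k | u.1 = s.1} h0
      (h ▸ natDegree_gradeBy_row_perm_le F s.1) rfl ht hs
    exact (Finset.mem_union.1 (vars_mul f g (h ▸ mem_vars_perm_generic F t))).resolve_right hg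
  refine isUnit_of_vars_eq_empty (right_ne_zero_of_mul h0) (Finset.eq_empty_of_forall_notMem ?_)
  intro t
  exact notMem_vars_of_natDegree_gradeBy_mul_le_one {u : Fin k × Fin k | u.2 = t.2} h0
    (h ▸ natDegree_gradeBy_col_perm_le F t.2) (s := (s.1, t.2)) rfl rfl
    (hrow _ rfl)

/-- For an arbitrary field `F` and `k ≥ 2`, the permanent of the generic `k × k` matrix,
`perm(M) = Σ_{σ ∈ Sym(Fin k)} Π_i X(i, σ i)`, is an irreducible polynomial. -/
theorem statement5 (F : Type*) [Field F] (k : ℕ) (hk : 2 ≤ k) :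
    Irreducible (perm (Matrix.of fun i j : Fin k => (X (i, j) : MvPolynomial (Fin k × Fin k) F))) := by
  have hvar := mem_vars_perm_generic F ((⟨0, by omega⟩, ⟨0, by omega⟩) : Fin k × Fin k)
  refine ⟨fun hu => ?_, fun f g h => ?_⟩
  · rw [(isUnit_iff_eq_C_of_isReduced.1 hu).choose_spec.2, vars_C] at hvar
    simp at hvar
  · have h0 : f * g ≠ 0 := by
      intro h'
      rw [h, h'] at hvar
      simp at hvar
    classical
    rw [h] at hvar
    rcases Finset.mem_union.1 (vars_mul f g hvar) with hf | hg
    · exact .inr (isUnit_right_of_perm_eq_mul h0 h hf)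
    · rw [mul_comm] at h h0
      exact .inl (isUnit_right_of_perm_eq_mul h0 h hg)

end
end

section
/- Let F be a field, let M be the generic k×n matrix over F, and let 1 ≤ h ≤ min(k, n). Then the family of permanents of all h×h submatrices of M (indexed by pairs of strictly monotone maps Fin h → Fin k and Fin h → Fin n selecting rows and columns) is linearly independent in the polynomial ring MvPolynomial (Fin k × Fin n) F. -/
open MvPolynomial

noncomputable section

/-- The exponent vector of a product of variables determines the set of variables occurring. -/
theorem range_eq_of_sum_single_eq {ι κ : Type*} [Fintype ι] {f g : ι → κ}
    (h : ∑ a, Finsupp.single (f a) 1 = (∑ a, Finsupp.single (g a) 1 : κ →₀ ℕ)) :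
    Set.range f = Set.range g := by
  classical
  have key : ∀ (f : ι → κ) (p : κ),
      p ∈ Set.range f ↔ (∑ a, Finsupp.single (f a) 1 : κ →₀ ℕ) p ≠ 0 := by
    intro f p
    simp [Finsupp.finsetSum_apply, Finsupp.single_apply]
  ext p
  rw [key f, key g, h]

/-- Among the monomials in the permanents of submatrices of the generic matrix, the diagonal
monomial of a submatrix occurs only once. -/
theorem eq_of_range_eq {α β : Type*} [LinearOrder α] [LinearOrder β] {h : ℕ}
    {r r' : Fin h → α} {c c' : Fin h → β} (hr : StrictMono r) (hr' : StrictMono r')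
    (hc : StrictMono c) (hc' : StrictMono c') (σ : Equiv.Perm (Fin h))
    (H : Set.range (fun a => (r' a, c' (σ a))) = Set.range (fun a => (r a, c a))) :
    r' = r ∧ c' = c ∧ σ = 1 := by
  have hrr : r' = r := by
    refine (hr'.range_inj hr).1 ?_
    simpa [← Set.range_comp, Function.comp_def] using congrArg (Set.image Prod.fst) H
  have hcc : c' = c := by
    refine (hc'.range_inj hc).1 ?_
    rw [← σ.surjective.range_comp c']
    simpa [← Set.range_comp, Function.comp_def] using congrArg (Set.image Prod.snd) H
  subst hrr hcc
  refine ⟨rfl, rfl, Equiv.ext fun a => ?_⟩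
  obtain ⟨b, hb⟩ := H.subset ⟨a, rfl⟩
  simp only [Prod.mk.injEq] at hb
  obtain rfl := hr.injective hb.1
  exact (hc.injective hb.2).symm

theorem coeff_perm_of_X {F κ : Type*} [CommRing F] [DecidableEq κ] {h : ℕ}
    (v : Fin h → Fin h → κ) (d : κ →₀ ℕ) :
    coeff d (perm (Matrix.of fun a b => (X (v a b) : MvPolynomial κ F))) =
      ∑ σ : Equiv.Perm (Fin h), if ∑ a, Finsupp.single (v a (σ a)) 1 = d then 1 else 0 := by
  simp only [perm, Matrix.of_apply, coeff_sum]
  refine Finset.sum_congr rfl fun σ _ => ?_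
  have : (∏ a, X (v a (σ a)) : MvPolynomial κ F) =
      monomial (∑ a, Finsupp.single (v a (σ a)) 1) 1 := by
    rw [monomial_sum_one]
    rfl
  rw [this, coeff_monomial]

/-- For a field `F` and `1 ≤ h ≤ min(k, n)`, the permanents of all `h × h` submatrices of
the generic `k × n` matrix — indexed by pairs of strictly monotone maps selecting `h` rows
and `h` columns — are linearly independent in `MvPolynomial (Fin k × Fin n) F`. -/
theorem statement6 (F : Type*) [Field F] (k n h : ℕ) (h1 : 1 ≤ h) (hk : h ≤ k) (hn : h ≤ n) :
    LinearIndependent F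
      (fun rc : { r : Fin h → Fin k // StrictMono r } × { c : Fin h → Fin n // StrictMono c } =>
        perm (Matrix.of fun a b =>
          (X (rc.1.1 a, rc.2.1 b) : MvPolynomial (Fin k × Fin n) F))) := by
  refine LinearIndependent.of_pairwise_dual_eq_zero_one _
    (fun rc => lcoeff F (∑ a, Finsupp.single (rc.1.1 a, rc.2.1 a) 1)) ?_ ?_
  · rintro ⟨⟨r, hr⟩, ⟨c, hc⟩⟩ ⟨⟨r', hr'⟩, ⟨c', hc'⟩⟩ hne
    rw [lcoeff_apply, coeff_perm_of_X (fun a b => (r' a, c' b))]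
    refine Finset.sum_eq_zero fun σ _ => if_neg fun H => hne ?_
    obtain ⟨rfl, rfl, -⟩ := eq_of_range_eq hr hr' hc hc' σ (range_eq_of_sum_single_eq H)
    rfl
  · rintro ⟨⟨r, hr⟩, ⟨c, hc⟩⟩
    rw [lcoeff_apply, coeff_perm_of_X (fun a b => (r a, c b)), Finset.sum_eq_single 1]
    · simp
    · exact fun σ _ hσ => if_neg fun H =>
        hσ (eq_of_range_eq hr hr hc hc σ (range_eq_of_sum_single_eq H)).2.2
    · simp

end
end

section
/- Let F be a field of characteristic zero and k ≥ 1. The k+1 maximal permanents of the generic k×(k+1) matrix, i.e., the family (perm_j)_{j ∈ Fin (k+1)} where perm_j is the permanent of the k×k submatrix of M obtained by deleting column j, is algebraically independent over F in MvPolynomial (Fin k × Fin (k+1)) F. -/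
open MvPolynomial

noncomputable section

theorem map_perm {R S : Type*} [CommRing R] [CommRing S] (f : R →+* S) {m : ℕ}
    (A : Matrix (Fin m) (Fin m) R) : f (perm A) = perm (A.map f) := by
  simp [perm, map_sum, map_prod]

/-- A permutation supported on the pattern of a bidiagonal `k × (k+1)` matrix with column `j`
deleted is the identity. -/
theorem perm_eq_one_of_bidiagonal {k : ℕ} (j : Fin (k + 1)) (σ : Equiv.Perm (Fin k))
    (h : ∀ i, j.succAbove (σ i) = i.castSucc ∨ j.succAbove (σ i) = i.succ) : σ = 1 := by
  have key (i : Fin k) : ((σ i : ℕ) < j ∧ ((σ i : ℕ) = i ∨ (σ i : ℕ) = i + 1)) ∨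
      ((j : ℕ) ≤ σ i ∧ ((σ i : ℕ) + 1 = i ∨ (σ i : ℕ) = i)) := by
    have hi := h i
    simp only [Fin.succAbove, Fin.lt_def, Fin.ext_iff] at hi
    split_ifs at hi with hlt <;> simp at hi hlt <;> omega
  have inj (a b : Fin k) (hab : (σ a : ℕ) = σ b) : (a : ℕ) = b :=
    congrArg Fin.val (σ.injective (Fin.ext hab))
  have upper : ∀ n (hn : n < k), (j : ℕ) ≤ n → (σ ⟨n, hn⟩ : ℕ) = n := by
    intro n
    induction n with
    | zero => intro hn hj; have := key ⟨0, hn⟩; simp at this; omega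
    | succ n ih =>
      intro hn hj
      have h1 := key ⟨n + 1, hn⟩
      have h2 := ih (by omega)
      have h3 := inj ⟨n + 1, hn⟩ ⟨n, by omega⟩
      simp at h1 h3
      omega
  have lower : ∀ d n (hn : n < k), n + d + 1 = j → (σ ⟨n, hn⟩ : ℕ) = n := by
    intro d
    induction d with
    | zero => intro n hn hj; have := key ⟨n, hn⟩; simp at this; omega
    | succ d ih =>
      intro n hn hj
      have h1 := key ⟨n, hn⟩
      have h2 := ih (n + 1) (by omega) (by omega)
      have h3 := inj ⟨n, hn⟩ ⟨n + 1, by omega⟩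
      simp at h1 h3
      omega
  ext i
  rcases le_or_gt (j : ℕ) i with hj | hj
  · exact upper i i.2 hj
  · exact lower (j - i - 1) i i.2 (by omega)

/-- A bidiagonal `k × (k+1)` matrix whose maximal permanents are the prescribed values `z j`. -/
def bidiagonal {K : Type*} [Field K] {k : ℕ} (z : Fin (k + 1) → K) (i : Fin k)
    (c : Fin (k + 1)) : K :=
  (if (i : ℕ) = 0 then z 0 else 1) *
    if c = i.castSucc then z i.succ / z i.castSucc else if c = i.succ then 1 else 0

theorem mul_prod_ratio {K : Type*} [Field K] {k : ℕ} (z : Fin (k + 1) → K)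
    (hz : ∀ j, z j ≠ 0) (j : Fin (k + 1)) :
    z 0 * ∏ i : Fin k, (if i.castSucc < j then z i.succ / z i.castSucc else 1) = z j := by
  induction j using Fin.induction with
  | zero => simp
  | succ j ih =>
    have split (i : Fin k) : (if i.castSucc < j.succ then z i.succ / z i.castSucc else 1) =
        (if i.castSucc < j.castSucc then z i.succ / z i.castSucc else 1) *
          if i = j then z i.succ / z i.castSucc else 1 := by
      rcases lt_trichotomy i j with h | rfl | h
      · simp [h, h.ne, h.le]
      · simp
      · simp [h.ne', h.not_gt, h.not_ge]
    simp_rw [split, Finset.prod_mul_distrib, ← mul_assoc, ih]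
    simp [mul_div_cancel₀, hz]

theorem perm_bidiagonal {K : Type*} [Field K] {k : ℕ} (hk : 1 ≤ k) (z : Fin (k + 1) → K)
    (hz : ∀ j, z j ≠ 0) (j : Fin (k + 1)) :
    perm (Matrix.of fun i i' : Fin k => bidiagonal z i (j.succAbove i')) = z j := by
  rw [perm, Finset.sum_eq_single 1]
  · have entry (i : Fin k) : bidiagonal z i (j.succAbove i) =
        (if (i : ℕ) = 0 then z 0 else 1) *
          if i.castSucc < j then z i.succ / z i.castSucc else 1 := by
      unfold bidiagonal Fin.succAbove
      split_ifs <;> simp_all [Fin.ext_iff]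
    have first : ∏ i : Fin k, (if (i : ℕ) = 0 then z 0 else 1) = z 0 := by
      rw [Finset.prod_eq_single ⟨0, hk⟩] <;> simp [Fin.ext_iff]
      tauto
    simp only [Matrix.of_apply, Equiv.Perm.one_apply, entry, Finset.prod_mul_distrib, first]
    exact mul_prod_ratio z hz j
  · intro σ _ hσ
    contrapose! hσ
    refine perm_eq_one_of_bidiagonal j σ fun i => ?_
    have hi := Finset.prod_ne_zero_iff.mp hσ i (Finset.mem_univ i)
    by_contra! hn
    simp [bidiagonal, hn.1, hn.2] at hi
  · simp

/-- For a field `F` of characteristic zero and `k ≥ 1`, the `k + 1` maximal permanents of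
the generic `k × (k+1)` matrix — `perm_j` being the permanent of the `k × k` submatrix
obtained by deleting column `j` — are algebraically independent over `F`. -/
theorem statement7 (F : Type*) [Field F] [CharZero F] (k : ℕ) (hk : 1 ≤ k) :
    AlgebraicIndependent F (fun j : Fin (k + 1) =>
      perm (Matrix.of fun i i' : Fin k =>
        (X (i, j.succAbove i') : MvPolynomial (Fin k × Fin (k + 1)) F))) := by
  let P := MvPolynomial (Fin (k + 1)) F
  let z : Fin (k + 1) → FractionRing P := fun j => algebraMap P (FractionRing P) (X j)
  have inj : Function.Injective (algebraMap P (FractionRing P)) :=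
    IsFractionRing.injective P (FractionRing P)
  have hz (j) : z j ≠ 0 := (map_ne_zero_iff _ inj).mpr (X_ne_zero j)
  have hind : AlgebraicIndependent F z :=
    (MvPolynomial.algebraicIndependent_X (Fin (k + 1)) F).map'
      (f := IsScalarTower.toAlgHom F P (FractionRing P)) inj
  let φ : MvPolynomial (Fin k × Fin (k + 1)) F →ₐ[F] FractionRing P :=
    aeval fun p => bidiagonal z p.1 p.2
  refine AlgebraicIndependent.of_comp φ ?_
  convert hind using 1
  funext j
  refine (map_perm φ.toRingHom _).trans (Eq.trans ?_ (perm_bidiagonal hk z hz j))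
  congr 1
  ext i i'
  simp [φ]

end
end

section
/- Let k ≥ 3 and let K be the k×(k+1) Kirkup matrix over ℚ: for 1 ≤ i ≤ k−2 the i-th row is (1,…,1, 2−3k) (with 1 in columns 1 through k); the (k−1)-st row is (1,…,1, 2−2k, (k−2)(k−1)) (with 1 in columns 1 through k−1); the k-th row is (1,…,1, k, (2k−1)(k−2)) (with 1 in columns 1 through k−1). Then for every j ∈ {1,…,k+1}, the permanent of the k×k matrix obtained from K by deleting column j is zero; i.e., prk(K) ≤ k−1. -/
noncomputable section

/-- The `k × (k+1)` Kirkup matrix over `ℚ` (rows and columns indexed from `0`):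
for `i ≤ k - 3` the `i`-th row is `(1, …, 1, 2 - 3k)`; the `(k-2)`-nd row is
`(1, …, 1, 2 - 2k, (k-2)(k-1))`; the `(k-1)`-st row is `(1, …, 1, k, (2k-1)(k-2))`. -/
def kirkupMatrix (k : ℕ) : Matrix (Fin k) (Fin (k + 1)) ℚ :=
  Matrix.of fun i j =>
    if i.val < k - 2 then
      (if j.val = k then 2 - 3 * (k : ℚ) else 1)
    else if i.val = k - 2 then
      (if j.val = k then ((k : ℚ) - 2) * ((k : ℚ) - 1)
       else if j.val = k - 1 then 2 - 2 * (k : ℚ) else 1)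
    else
      (if j.val = k then (2 * (k : ℚ) - 1) * ((k : ℚ) - 2)
       else if j.val = k - 1 then (k : ℚ) else 1)

open Finset in
/-- The sum of `u (σ p) * v (σ q)` over all permutations `σ` vanishes as soon as the sum of
`u a * v b` over all pairs `a ≠ b` does. -/
lemma sum_perm_mul_eq_zero {ι R : Type*} [Fintype ι] [DecidableEq ι] [CommRing R] [IsDomain R]
    [CharZero R] (u v : ι → R) {p q : ι} (hpq : p ≠ q)
    (h : (∑ i, u i) * ∑ i, v i = ∑ i, u i * v i) :
    ∑ σ : Equiv.Perm ι, u (σ p) * v (σ q) = 0 := by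
  have hq : ∀ a b, a ≠ b → ∑ σ : Equiv.Perm ι, u (σ a) * v (σ b) =
      ∑ σ : Equiv.Perm ι, u (σ p) * v (σ q) := by
    intro a b hab
    obtain ⟨τ, hτa, hτb⟩ : ∃ τ : Equiv.Perm ι, τ p = a ∧ τ q = b := by
      refine ⟨(Equiv.swap p a).trans (Equiv.swap (Equiv.swap p a q) b), ?_, ?_⟩
      · have h1 : a ≠ Equiv.swap p a q := fun h1 => hpq <| by
          simpa using congrArg (Equiv.swap p a) h1
        simp [Equiv.swap_apply_of_ne_of_ne h1 hab]
      · simp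
    exact Fintype.sum_equiv (Equiv.mulRight τ) _ _ fun σ => by simp [hτa, hτb]
  have hsum : ∑ x ∈ univ.offDiag, ∑ σ : Equiv.Perm ι, u (σ x.1) * v (σ x.2) = 0 := by
    rw [sum_comm]
    refine sum_eq_zero fun σ _ => ?_
    have hd := sum_union (disjoint_diag_offDiag (univ : Finset ι))
      (f := fun x : ι × ι => u (σ x.1) * v (σ x.2))
    rw [diag_union_offDiag, sum_product, sum_diag] at hd
    simp only [← mul_sum, ← sum_mul, Equiv.sum_comp σ u, Equiv.sum_comp σ v,
      Equiv.sum_comp σ fun i => u i * v i, h] at hd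
    simpa using hd
  rw [sum_congr rfl fun x hx => hq x.1 x.2 (mem_offDiag.1 hx).2.2, sum_const, smul_eq_zero] at hsum
  refine hsum.resolve_left fun h0 => ?_
  have hmem : (p, q) ∈ (univ : Finset ι).offDiag := by simp [hpq]
  simp [card_eq_zero.1 h0] at hmem

/-- The permanent of a matrix all of whose columns other than `p` and `q` consist of ones. -/
lemma perm_eq_zero_of_two_columns {R : Type*} [CommRing R] [IsDomain R] [CharZero R] {m : ℕ}
    (A : Matrix (Fin m) (Fin m) R) {p q : Fin m} (hpq : p ≠ q)
    (hA : ∀ i j, j ≠ p → j ≠ q → A i j = 1)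
    (h : (∑ i, A i p) * ∑ i, A i q = ∑ i, A i p * A i q) : perm A = 0 := by
  rw [← sum_perm_mul_eq_zero (fun i => A i p) (fun i => A i q) hpq h, perm]
  refine Fintype.sum_equiv (Equiv.inv _) _ _ fun σ => ?_
  rw [← Equiv.prod_comp σ⁻¹]
  simp only [Equiv.Perm.inv_def, Equiv.apply_symm_apply, Equiv.inv_apply]
  exact Fintype.prod_eq_mul p q hpq fun x hx => hA _ _ hx.1 hx.2

/-- For `k ≥ 3`, every maximal (`k × k`) permanent of the Kirkup matrix vanishes:
deleting any column `j` of `K_{k,k+1}` yields a `k × k` matrix with zero permanent,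
i.e. `prk(K) ≤ k - 1`. -/
theorem statement11 (k : ℕ) (hk : 3 ≤ k) (j : Fin (k + 1)) :
    perm (Matrix.of fun i i' : Fin k => kirkupMatrix k i (j.succAbove i')) = 0 := by
  obtain ⟨n, rfl⟩ : ∃ n, k = n + 2 := ⟨k - 2, by omega⟩
  have hval (i : Fin (n + 2)) : (j.succAbove i).val =
      if i.val < j.val then i.val else i.val + 1 := by
    simp only [Fin.succAbove, Fin.lt_def, Fin.val_castSucc]
    split_ifs <;> simp
  have hj := j.isLt
  refine perm_eq_zero_of_two_columns _ (p := (Fin.last n).castSucc) (q := Fin.last (n + 1))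
    (Fin.castSucc_lt_last _).ne (fun i c hp hq => ?_) ?_
  · have hc : c.val < n := by
      have := c.isLt
      simp only [ne_eq, Fin.ext_iff, Fin.val_castSucc, Fin.val_last] at hp hq
      omega
    have h1 : (j.succAbove c).val ≠ n + 2 := by rw [hval]; split_ifs <;> omega
    have h2 : (j.succAbove c).val ≠ n + 1 := by rw [hval]; split_ifs <;> omega
    simp [kirkupMatrix, h1, h2]
  · rcases (by omega : j.val ≤ n ∨ j.val = n + 1 ∨ j.val = n + 2) with h | h | h
    · have h1 : ¬ n < j.val := by omega
      have h2 : ¬ n + 1 < j.val := by omega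
      simp [kirkupMatrix, hval, h1, h2, Fin.sum_univ_castSucc]
      ring
    · simp [kirkupMatrix, hval, h, Fin.sum_univ_castSucc]
      ring
    · simp [kirkupMatrix, hval, h, Fin.sum_univ_castSucc]
      ring

end
end

section
/- Let F be a field, k ≥ 2, and let S_k ⊆ MvPolynomial (Fin k × Fin k) F be the ideal generated by the permanents of all (k−1)×(k−1) submatrices of the generic k×k matrix M. For a subset R ⊆ Fin k of rows, let J_R be the ideal generated by the permanents of all |R|×|R| submatrices of M whose row set is exactly R (with any choice of |R| columns). Then for every partition Fin k = R_1 ⊔ R_2 of the rows (R_1, R_2 disjoint with union Fin k), one has S_k ⊆ J_{R_1} + J_{R_2}; the analogous containment holds for any partition of the columns. -/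
open MvPolynomial

noncomputable section

/-- `J_R`: the ideal generated by the permanents of all `|R| × |R|` submatrices of the
generic `k × k` matrix whose row set is exactly `R` (with any choice of `|R|` columns,
selected by a strictly monotone map). -/
def rowIdeal (F : Type*) [Field F] (k : ℕ) (R : Finset (Fin k)) :
    Ideal (MvPolynomial (Fin k × Fin k) F) :=
  Ideal.span { p | ∃ c : Fin R.card → Fin k, StrictMono c ∧
    p = perm (Matrix.of fun a b => X (R.orderEmbOfFin rfl a, c b)) }

/-- `J_C`: the ideal generated by the permanents of all `|C| × |C|` submatrices of the
generic `k × k` matrix whose column set is exactly `C` (with any choice of `|C|` rows,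
selected by a strictly monotone map). -/
def colIdeal (F : Type*) [Field F] (k : ℕ) (C : Finset (Fin k)) :
    Ideal (MvPolynomial (Fin k × Fin k) F) :=
  Ideal.span { p | ∃ r : Fin C.card → Fin k, StrictMono r ∧
    p = perm (Matrix.of fun a b => X (r a, C.orderEmbOfFin rfl b)) }

/-- The permanent is invariant under transposition. -/
theorem perm_transpose {A : Type*} [CommRing A] {m : ℕ} (M : Matrix (Fin m) (Fin m) A) :
    perm M.transpose = perm M :=
  (Matrix.permanent_transpose M).symm

/-- An injective map factors through the increasing enumeration of its image. -/
theorem exists_equiv_eq_orderEmbOfFin {T α : Type*} [LinearOrder α] (g : T → α)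
    (hg : Function.Injective g) (S : Finset α) (hS : ∀ x, x ∈ S ↔ x ∈ Set.range g)
    {n : ℕ} (hn : S.card = n) : ∃ e : T ≃ Fin n, ∀ a, g a = S.orderEmbOfFin hn (e a) := by
  have hmem (a : T) : g a ∈ S := (hS _).2 ⟨a, rfl⟩
  have hb : Function.Bijective fun a => (⟨g a, hmem a⟩ : S) := by
    refine ⟨fun a b h => hg (congrArg Subtype.val h), ?_⟩
    rintro ⟨x, hx⟩
    obtain ⟨a, rfl⟩ := (hS x).1 hx
    exact ⟨a, rfl⟩
  refine ⟨(Equiv.ofBijective _ hb).trans (S.orderIsoOfFin hn).symm.toEquiv, fun a => ?_⟩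
  rw [← Finset.coe_orderIsoOfFin_apply]
  simp

/-- Ideal form of the generalized Laplace expansion of a permanent along the rows satisfying
`p`: if the permanents of all square submatrices on these rows lie in an ideal, so does the
permanent of the full matrix. -/
theorem sum_perm_prod_mem_of_subtype {ι A : Type*} [Fintype ι] [DecidableEq ι] [CommRing A]
    (M : ι → ι → A) (p : ι → Prop) [DecidablePred p] (J : Ideal A)
    (h : ∀ σ : Equiv.Perm ι, ∑ τ : Equiv.Perm {a // p a}, ∏ a, M a.1 (σ (τ a).1) ∈ J) :
    ∑ σ : Equiv.Perm ι, ∏ i, M i (σ i) ∈ J := by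
  classical
  let φ : Equiv.Perm {a // p a} →* Equiv.Perm ι := Equiv.Perm.ofSubtype
  obtain ⟨S, hS, -⟩ := φ.range.exists_isComplement_left 1
  let e : S × Equiv.Perm {a // p a} ≃ Equiv.Perm ι :=
    ((Equiv.refl _).prodCongr
      (MonoidHom.ofInjective (f := φ) Equiv.Perm.ofSubtype_injective).toEquiv).trans
      hS.equiv.symm
  have he (q τ) : e (q, τ) = q.1 * φ τ := rfl
  rw [← e.sum_comp, Fintype.sum_prod_type]
  refine J.sum_mem fun q _ => ?_
  have key (τ : Equiv.Perm {a // p a}) : ∏ i, M i (e (q, τ) i) =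
      (∏ a : {a // ¬ p a}, M a.1 (q.1 a.1)) * ∏ a : {a // p a}, M a.1 (q.1 (τ a).1) := by
    rw [← Fintype.prod_subtype_mul_prod_subtype p, mul_comm]
    congr 1
    · refine Finset.prod_congr rfl fun a _ => ?_
      rw [he, Equiv.Perm.mul_apply, Equiv.Perm.ofSubtype_apply_of_not_mem τ a.2]
    · refine Finset.prod_congr rfl fun a _ => ?_
      rw [he, Equiv.Perm.mul_apply, Equiv.Perm.ofSubtype_apply_coe]
  simp only [key]
  rw [← Finset.mul_sum]
  exact J.mul_mem_left _ (h _)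

/-- If an ideal contains the permanents of all square submatrices with row set `R`, then it
contains the permanent of every square submatrix whose rows include `R`. -/
theorem perm_mem_of_subset_range {A α β : Type*} [CommRing A] [LinearOrder α] [LinearOrder β]
    (Y : α → β → A) (J : Ideal A) (R : Finset α)
    (hJ : ∀ c : Fin R.card → β, StrictMono c →
      perm (Matrix.of fun a b => Y (R.orderEmbOfFin rfl a) (c b)) ∈ J)
    {m : ℕ} (r : Fin m → α) (c : Fin m → β) (hr : Function.Injective r)
    (hc : Function.Injective c) (hR : ∀ x ∈ R, x ∈ Set.range r) :
    perm (Matrix.of fun a b => Y (r a) (c b)) ∈ J := by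
  refine sum_perm_prod_mem_of_subtype (fun a b => Y (r a) (c b)) (fun a => r a ∈ R) J
    fun σ => ?_
  obtain ⟨e, he⟩ := exists_equiv_eq_orderEmbOfFin (fun a : {a // r a ∈ R} => r a.1)
    (fun a b h => Subtype.ext (hr h)) R
    (fun x => ⟨fun hx => by obtain ⟨a, rfl⟩ := hR x hx; exact ⟨⟨a, hx⟩, rfl⟩,
      by rintro ⟨a, rfl⟩; exact a.2⟩) rfl
  have hd : Function.Injective fun a : {a // r a ∈ R} => c (σ a.1) :=
    fun a b h => Subtype.ext (σ.injective (hc h))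
  have hcard : (Finset.univ.image fun a : {a // r a ∈ R} => c (σ a.1)).card = R.card := by
    rw [Finset.card_image_of_injective _ hd, Finset.card_univ, Fintype.card_congr e,
      Fintype.card_fin]
  obtain ⟨f, hf⟩ := exists_equiv_eq_orderEmbOfFin _ hd _ (fun x => by simp) hcard
  convert hJ _ (OrderEmbedding.strictMono (Finset.orderEmbOfFin _ hcard)) using 1
  rw [perm, ← (Equiv.equivCongr e f).sum_comp]
  refine Finset.sum_congr rfl fun τ _ => ?_
  rw [← e.prod_comp]
  refine Finset.prod_congr rfl fun a _ => ?_
  simp [← he, ← hf]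

/-- An injective map from `Fin (k - 1)` to `Fin k` misses at most one point, so its range
contains one of any two disjoint sets. -/
theorem subset_range_or_subset_range {k : ℕ} (hk : 2 ≤ k) (r : Fin (k - 1) → Fin k)
    (hr : Function.Injective r) (R1 R2 : Finset (Fin k)) (hR : Disjoint R1 R2) :
    (∀ x ∈ R1, x ∈ Set.range r) ∨ (∀ x ∈ R2, x ∈ Set.range r) := by
  by_contra! h
  obtain ⟨⟨x, hx, hxr⟩, y, hy, hyr⟩ := h
  have hxy : x ≠ y := fun h => Finset.disjoint_left.1 hR hx (h ▸ hy)
  have hcard := Finset.card_le_univ (insert x (insert y (Finset.univ.image r)))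
  rw [Finset.card_insert_of_notMem (by simpa [hxy] using hxr),
    Finset.card_insert_of_notMem (by simpa using hyr),
    Finset.card_image_of_injective _ hr] at hcard
  simp at hcard
  omega

/-- For any partition of the rows `Fin k = R₁ ⊔ R₂`, one has `S_k ⊆ J_{R₁} + J_{R₂}`,
and the analogous containment for any partition of the columns. -/
theorem statement18 (F : Type*) [Field F] (k : ℕ) (hk : 2 ≤ k) :
    (∀ R1 R2 : Finset (Fin k), Disjoint R1 R2 → R1 ∪ R2 = Finset.univ →
      singularIdeal F k ≤ rowIdeal F k R1 + rowIdeal F k R2) ∧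
    (∀ C1 C2 : Finset (Fin k), Disjoint C1 C2 → C1 ∪ C2 = Finset.univ →
      singularIdeal F k ≤ colIdeal F k C1 + colIdeal F k C2) := by
  constructor
  · refine fun R1 R2 hd _ => Ideal.span_le.2 ?_
    rintro _ ⟨r, c, hr, hc, rfl⟩
    have key (R : Finset (Fin k)) (h : ∀ x ∈ R, x ∈ Set.range r) :
        perm (Matrix.of fun a b => X (r a, c b)) ∈ rowIdeal F k R :=
      perm_mem_of_subset_range (fun i j => X (i, j)) (rowIdeal F k R) R
        (fun _ hs => Ideal.subset_span ⟨_, hs, rfl⟩) r c hr.injective hc.injective h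
    rcases subset_range_or_subset_range hk r hr.injective R1 R2 hd with h | h
    · exact Ideal.mem_sup_left (key R1 h)
    · exact Ideal.mem_sup_right (key R2 h)
  · refine fun C1 C2 hd _ => Ideal.span_le.2 ?_
    rintro _ ⟨r, c, hr, hc, rfl⟩
    have key (C : Finset (Fin k)) (h : ∀ x ∈ C, x ∈ Set.range c) :
        perm (Matrix.of fun a b => X (r a, c b)) ∈ colIdeal F k C := by
      rw [← perm_transpose]
      exact perm_mem_of_subset_range (fun i j => X (j, i)) (colIdeal F k C) C
        (fun _ hs => Ideal.subset_span ⟨_, hs, perm_transpose _⟩) c r hc.injective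
        hr.injective h
    rcases subset_range_or_subset_range hk c hc.injective C1 C2 hd with h | h
    · exact Ideal.mem_sup_left (key C1 h)
    · exact Ideal.mem_sup_right (key C2 h)

end
end

section
/- The ten 2×2 permanents of the generic 2×5 matrix over ℚ are algebraically dependent: the family (X(0,i)·X(1,j) + X(0,j)·X(1,i)) indexed by pairs 0 ≤ i < j ≤ 4 in MvPolynomial (Fin 2 × Fin 5) ℚ is NOT algebraically independent over ℚ. -/
open MvPolynomial

/-- The pentad of an array `s`: the signed sum, over the twelve 5-cycles on `Fin 5`, of the
products of the entries of `s` at the edges of the cycle. Only the entries `s i j` with `i < j`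
occur. -/
def pentad {R : Type*} [CommRing R] (s : Fin 5 → Fin 5 → R) : R :=
  s 0 1 * s 0 4 * s 1 2 * s 2 3 * s 3 4
    - s 0 1 * s 0 3 * s 1 2 * s 2 4 * s 3 4
    - s 0 1 * s 0 4 * s 1 3 * s 2 3 * s 2 4
    + s 0 1 * s 0 2 * s 1 3 * s 2 4 * s 3 4
    + s 0 1 * s 0 3 * s 1 4 * s 2 3 * s 2 4
    - s 0 1 * s 0 2 * s 1 4 * s 2 3 * s 3 4
    - s 0 2 * s 0 4 * s 1 2 * s 1 3 * s 3 4
    + s 0 2 * s 0 3 * s 1 2 * s 1 4 * s 3 4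
    + s 0 2 * s 0 4 * s 1 3 * s 1 4 * s 2 3
    - s 0 2 * s 0 3 * s 1 3 * s 1 4 * s 2 4
    + s 0 3 * s 0 4 * s 1 2 * s 1 3 * s 2 4
    - s 0 3 * s 0 4 * s 1 2 * s 1 4 * s 2 3

theorem map_pentad {R S : Type*} [CommRing R] [CommRing S] (f : R →+* S)
    (s : Fin 5 → Fin 5 → R) : f (pentad s) = pentad fun i j => f (s i j) := by
  simp only [pentad, map_add, map_sub, map_mul]

/-- The pentad vanishes on the `2 × 2` permanents of a `2 × 5` matrix. -/
theorem pentad_permanent {R : Type*} [CommRing R] (a b : Fin 5 → R) :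
    pentad (fun i j => a i * b j + a j * b i) = 0 := by
  unfold pentad
  ring

/-- The pentad in indeterminates indexed by the pairs `i < j`. -/
noncomputable def pentadPolynomial (R : Type*) [CommRing R] :
    MvPolynomial { q : Fin 5 × Fin 5 // q.1 < q.2 } R :=
  pentad fun i j => if h : i < j then X ⟨(i, j), h⟩ else 0

theorem aeval_pentadPolynomial {R A : Type*} [CommRing R] [CommRing A] [Algebra R A]
    (s : Fin 5 → Fin 5 → A) :
    aeval (fun p : { q : Fin 5 × Fin 5 // q.1 < q.2 } => s p.1.1 p.1.2)
      (pentadPolynomial R) = pentad s := by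
  rw [pentadPolynomial, ← AlgHom.coe_toRingHom, map_pentad]
  simp [pentad]

theorem pentadPolynomial_ne_zero (R : Type*) [CommRing R] [Nontrivial R] :
    pentadPolynomial R ≠ 0 := by
  intro h
  have key := aeval_pentadPolynomial (R := R)
    (fun i j : Fin 5 => if j = i + 1 ∨ i = j + 1 then (1 : R) else 0)
  rw [h, map_zero] at key
  simp [pentad, Fin.ext_iff] at key

/-- The ten `2 × 2` permanents of the generic `2 × 5` matrix over `ℚ`, indexed by the
pairs `0 ≤ i < j ≤ 4`, are algebraically dependent over `ℚ`. -/
theorem statement19 :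
    ¬ AlgebraicIndependent ℚ
      (fun p : { q : Fin 5 × Fin 5 // q.1 < q.2 } =>
        (X (0, p.1.1) * X (1, p.1.2) + X (0, p.1.2) * X (1, p.1.1) :
          MvPolynomial (Fin 2 × Fin 5) ℚ)) := by
  intro h
  refine pentadPolynomial_ne_zero ℚ (h.eq_zero_of_aeval_eq_zero _ ?_)
  exact (aeval_pentadPolynomial fun i j : Fin 5 =>
    (X (0, i) * X (1, j) + X (0, j) * X (1, i) : MvPolynomial (Fin 2 × Fin 5) ℚ)).trans
      (pentad_permanent (fun i => X (0, i)) fun i => X (1, i))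
end
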